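/- Let X and Y be real Banach spaces, let L⁻¹ : Y → X be a bounded linear operator, and let Q : [0,∞) → 𝓛(Y) be a family of bounded linear operators with ‖Q(t)‖ ≤ M₀ for all t ≥ 0 which is continuous in operator norm on (0,∞) (i.e., t ↦ Q(t) is continuous from (0,∞) to 𝓛(Y) with the operator norm). Fix 0 < α < 1 and define S_α(t)u = ∫₀^∞ ζ_α(θ) L⁻¹ Q(t^α θ) u dθ and T_α(t)u = α ∫₀^∞ θ ζ_α(θ) L⁻¹ Q(t^α θ) u dθ. Then t ↦ S_α(t) and t ↦ T_α(t) are continuous in operator norm on (0,∞): for each fixed t > 0 and ε > 0 there exists g > 0 such that ‖S_α(t+ε') − S_α(t)‖ < ε and ‖T_α(t+ε') − T_α(t)‖ < ε whenever t + ε' > 0 and |ε'| < g. -/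

import Mathlib

open MeasureTheory

/-- The Wright-type function `ϖ_α(θ)` for `0 < α < 1`. -/
noncomputable def wrightFn (α θ : ℝ) : ℝ :=
  (1 / Real.pi) * ∑' n : ℕ,
    (-1 : ℝ) ^ n * θ ^ (-(α * ((n : ℝ) + 1)) - 1) *
      (Real.Gamma (((n : ℝ) + 1) * α + 1) / (Nat.factorial (n + 1) : ℝ)) *
      Real.sin (((n : ℝ) + 1) * Real.pi * α)

/-- The probability density `ζ_α(θ) = (1/α) θ^{-1-1/α} ϖ_α(θ^{-1/α})`. -/
noncomputable def zetaFn (α θ : ℝ) : ℝ :=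
  (1 / α) * θ ^ (-1 - 1 / α) * wrightFn α (θ ^ (-(1 / α)))

theorem aux_cont {X Y : Type*} [NormedAddCommGroup X] [NormedSpace ℝ X] [CompleteSpace X]
    [NormedAddCommGroup Y] [NormedSpace ℝ Y]
    (Linv : Y →L[ℝ] X)
    (Q : ℝ → Y →L[ℝ] Y) (M₀ : ℝ) (hQ : ∀ t, 0 ≤ t → ‖Q t‖ ≤ M₀)
    (hQc : ContinuousOn Q (Set.Ioi 0)) (α : ℝ)
    (h : ℝ → ℝ) (hh : IntegrableOn h (Set.Ioi 0)) (S : ℝ → Y →L[ℝ] X)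
    (hS : ∀ t, 0 ≤ t → ∀ u : Y,
      S t u = ∫ θ in Set.Ioi (0 : ℝ), h θ • Linv (Q (t ^ α * θ) u)) (t : ℝ) (ht : 0 < t) :
    ContinuousAt S t := by
  have hcont : ∀ s : ℝ, 0 < s → ContinuousOn (fun θ => Linv.comp (Q (s ^ α * θ))) (Set.Ioi 0) := by
    intro s hs
    refine ContinuousOn.clm_comp continuousOn_const (hQc.comp (by fun_prop) ?_)
    intro θ hθ
    exact mul_pos (Real.rpow_pos_of_pos hs α) hθ
  have hmeas : ∀ s : ℝ, 0 < s → AEStronglyMeasurable (fun θ => h θ • Linv.comp (Q (s ^ α * θ)))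
      (volume.restrict (Set.Ioi 0)) := fun s hs =>
    hh.aestronglyMeasurable.smul ((hcont s hs).aestronglyMeasurable measurableSet_Ioi)
  have hbound : ∀ s : ℝ, 0 < s → ∀ᵐ θ ∂(volume.restrict (Set.Ioi (0:ℝ))),
      ‖h θ • Linv.comp (Q (s ^ α * θ))‖ ≤ ‖h θ‖ * (‖Linv‖ * M₀) := by
    intro s hs
    filter_upwards [ae_restrict_mem measurableSet_Ioi] with θ hθ
    rw [norm_smul]
    have h1 := hQ (s ^ α * θ) (mul_pos (Real.rpow_pos_of_pos hs α) hθ).le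
    gcongr
    exact (Linv.opNorm_comp_le _).trans (by gcongr)
  have hbi : Integrable (fun θ => ‖h θ‖ * (‖Linv‖ * M₀)) (volume.restrict (Set.Ioi (0:ℝ))) :=
    hh.norm.mul_const _
  have hint : ∀ s : ℝ, 0 < s → Integrable (fun θ => h θ • Linv.comp (Q (s ^ α * θ)))
      (volume.restrict (Set.Ioi 0)) := fun s hs => hbi.mono' (hmeas s hs) (hbound s hs)
  have hpos : ∀ᶠ s in nhds t, 0 < s := lt_mem_nhds ht
  have hSe : S =ᶠ[nhds t]
      fun s => ∫ θ in Set.Ioi (0 : ℝ), h θ • Linv.comp (Q (s ^ α * θ)) := by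
    filter_upwards [hpos] with s hs
    ext u
    rw [hS s hs.le, ContinuousLinearMap.integral_apply (hint s hs)]
    rfl
  refine ContinuousAt.congr ?_ hSe.symm
  refine continuousAt_of_dominated (hpos.mono hmeas) (hpos.mono hbound) hbi ?_
  filter_upwards [ae_restrict_mem measurableSet_Ioi] with θ hθ
  have h2 : ContinuousAt Q (t ^ α * θ) :=
    hQc.continuousAt (Ioi_mem_nhds (mul_pos (Real.rpow_pos_of_pos ht α) hθ))
  have h3 : ContinuousAt (fun s : ℝ => Q (s ^ α * θ)) t :=
    ContinuousAt.comp (f := fun s : ℝ => s ^ α * θ) h2 ((Real.continuousAt_rpow_const t α (Or.inl ht.ne')).mul continuousAt_const)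
  have h4 : ContinuousAt (fun s : ℝ => Linv.comp (Q (s ^ α * θ))) t :=
    ContinuousAt.clm_comp continuousAt_const h3
  exact h4.const_smul (h θ)

theorem aux_int (p b : ℝ) (hp : 0 ≤ p) (hb : 0 < b) :
    IntegrableOn (fun r : ℝ => r ^ p * Real.exp (-(b * r))) (Set.Ioi 0) := by
  have := integrableOn_rpow_mul_exp_neg_mul_rpow (p := 1) (s := p) (b := b) (by linarith)
    one_pos hb
  simpa [Real.rpow_one] using this

theorem aux_meas (p : ℝ) (w : ℂ) (hp : 0 ≤ p) :
    AEStronglyMeasurable (fun r : ℝ => ((r ^ p : ℝ) : ℂ) * Complex.exp (-(w * r)))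
      (volume.restrict (Set.Ioi 0)) := by
  have : Continuous (fun r : ℝ => ((r ^ p : ℝ) : ℂ) * Complex.exp (-(w * r))) := by
    have := Real.continuous_rpow_const hp
    fun_prop
  exact this.aestronglyMeasurable

theorem aux_norm (p : ℝ) (w : ℂ) (r : ℝ) (hr : 0 < r) :
    ‖((r ^ p : ℝ) : ℂ) * Complex.exp (-(w * r))‖ = r ^ p * Real.exp (-(w.re * r)) := by
  rw [norm_mul, Complex.norm_real, Complex.norm_exp, Real.norm_of_nonneg (by positivity)]
  simp

theorem aux_intC (p : ℝ) (w : ℂ) (hp : 0 ≤ p) (hw : 0 < w.re) :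
    IntegrableOn (fun r : ℝ => ((r ^ p : ℝ) : ℂ) * Complex.exp (-(w * r))) (Set.Ioi 0) := by
  refine (aux_int p w.re hp hw).mono' (aux_meas p w hp) ?_
  filter_upwards [ae_restrict_mem measurableSet_Ioi] with r hr
  exact (aux_norm p w r hr).le

theorem aux_gamma (p : ℝ) (hp : 0 ≤ p) (w : ℂ) (hw : 0 < w.re) :
    ∫ r in Set.Ioi (0:ℝ), ((r ^ p : ℝ) : ℂ) * Complex.exp (-(w * r)) =
      (Real.Gamma (p + 1) : ℂ) * Complex.exp (-((p + 1 : ℝ) * Complex.log w)) := by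
  have hop : IsOpen {z : ℂ | 0 < z.re} := isOpen_lt continuous_const Complex.continuous_re
  have hf : AnalyticOnNhd ℂ
      (fun w : ℂ => ∫ r in Set.Ioi (0:ℝ), ((r ^ p : ℝ) : ℂ) * Complex.exp (-(w * r)))
      {z : ℂ | 0 < z.re} := by
    refine DifferentiableOn.analyticOnNhd ?_ hop
    intro z hz
    have hz : 0 < z.re := hz
    refine DifferentiableAt.differentiableWithinAt ?_
    have hnh : {y : ℂ | z.re / 2 < y.re} ∈ nhds z :=
      (isOpen_lt continuous_const Complex.continuous_re).mem_nhds
        (by simp only [Set.mem_ofPred_eq]; linarith)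
    refine (hasDerivAt_integral_of_dominated_loc_of_deriv_le
      (F' := fun w r => -(((r ^ (p + 1) : ℝ) : ℂ) * Complex.exp (-(w * r))))
      (bound := fun r => r ^ (p + 1) * Real.exp (-(z.re / 2 * r))) hnh
      (Filter.Eventually.of_forall fun w => aux_meas p w hp) (aux_intC p z hp hz)
      (aux_meas (p + 1) z (by linarith)).neg ?_ (aux_int (p + 1) _ (by linarith) (by linarith))
      ?_).2.differentiableAt
    · filter_upwards [ae_restrict_mem measurableSet_Ioi] with r hr x hx
      have hr : 0 < r := hr
      have hx : z.re / 2 < x.re := hx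
      rw [norm_neg, aux_norm _ _ _ hr]
      gcongr
    · filter_upwards [ae_restrict_mem measurableSet_Ioi] with r hr x hx
      have hr : 0 < r := hr
      have h1 : HasDerivAt (fun x : ℂ => -(x * r)) (-(1 * (r:ℂ))) x :=
        ((hasDerivAt_id x).mul_const (r : ℂ)).neg
      convert! h1.cexp.const_mul ((r ^ p : ℝ) : ℂ) using 1
      rw [Real.rpow_add_one hr.ne']
      push_cast
      ring
  have hg : AnalyticOnNhd ℂ
      (fun w : ℂ => (Real.Gamma (p + 1) : ℂ) * Complex.exp (-((p + 1 : ℝ) * Complex.log w)))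
      {z : ℂ | 0 < z.re} := by
    refine DifferentiableOn.analyticOnNhd ?_ hop
    intro z hz
    have hz : z ∈ Complex.slitPlane := Or.inl hz
    refine DifferentiableAt.differentiableWithinAt ?_
    have := Complex.differentiableAt_log hz
    fun_prop
  have hpre : IsPreconnected {z : ℂ | 0 < z.re} := (convex_halfSpace_re_gt 0).isPreconnected
  refine hf.eqOn_of_preconnected_of_frequently_eq hg hpre (z₀ := ((1 : ℝ) : ℂ)) (by simp) ?_ hw
  have ht : Filter.Tendsto (fun x : ℝ => (x : ℂ)) (nhdsWithin 1 {1}ᶜ)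
      (nhdsWithin ((1 : ℝ) : ℂ) {((1 : ℝ) : ℂ)}ᶜ) := by
    refine tendsto_nhdsWithin_of_tendsto_nhds_of_eventually_within _
      (Complex.continuous_ofReal.continuousAt.mono_left nhdsWithin_le_nhds) ?_
    filter_upwards [self_mem_nhdsWithin] with x hx
    simpa using hx
  refine ht.frequently (Filter.Eventually.frequently ?_)
  filter_upwards [nhdsWithin_le_nhds (lt_mem_nhds (zero_lt_one' ℝ))] with x hx
  have h := Real.integral_rpow_mul_exp_neg_mul_Ioi (a := p + 1) (r := x) (by linarith) hx
  have h2 : ∫ r in Set.Ioi (0:ℝ), ((r ^ p : ℝ) : ℂ) * Complex.exp (-((x:ℂ) * r)) =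
    ((∫ r in Set.Ioi (0:ℝ), r ^ (p + 1 - 1) * Real.exp (-(x * r)) : ℝ) : ℂ) := by
    rw [← integral_complex_ofReal]
    congr 1
    ext r
    simp
  rw [h2, h, ← Complex.ofReal_log hx.le, one_div, Real.inv_rpow hx.le, ← Real.rpow_neg hx.le,
    Real.rpow_def_of_pos hx]
  push_cast
  rw [mul_comm]
  congr 2
  ring

theorem aux_summable (α : ℝ) (hα0 : 0 < α) (hα1 : α < 1) (K : ℝ) (hK : 0 < K) :
    Summable (fun n : ℕ => Real.Gamma (n * α + 1) / (n.factorial : ℝ) * K ^ n) := by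
  have hs : Summable (fun n : ℕ => K ^ n / (n.factorial : ℝ) ^ (1 - α)) := by
    refine summable_of_ratio_test_tendsto_lt_one (l := 0) one_pos
      (Filter.Eventually.of_forall fun n => by positivity) ?_
    have : Filter.Tendsto (fun n : ℕ => K * ((n : ℝ) + 1) ^ (-(1 - α))) Filter.atTop (nhds (K * 0)) := by
      refine Filter.Tendsto.const_mul K ?_
      refine (tendsto_rpow_neg_atTop (by linarith)).comp ?_
      exact Filter.tendsto_atTop_add_const_right _ _ tendsto_natCast_atTop_atTop
    rw [mul_zero] at this
    refine this.congr fun n => ?_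
    rw [Real.norm_of_nonneg (by positivity), Real.norm_of_nonneg (by positivity),
      Nat.factorial_succ, Nat.cast_mul, Real.mul_rpow (by positivity) (by positivity),
      Real.rpow_neg (by positivity)]
    push_cast
    field_simp
    ring
  refine hs.of_nonneg_of_le (fun n => ?_) (fun n => ?_)
  · have : 0 < Real.Gamma (n * α + 1) := Real.Gamma_pos_of_pos (by positivity)
    positivity
  · have h1 := Real.Gamma_mul_add_mul_le_rpow_Gamma_mul_rpow_Gamma (s := n + 1) (t := 1) (a := α)
      (b := 1 - α) (by positivity) one_pos hα0 (by linarith) (by ring)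
    rw [Real.Gamma_one, Real.one_rpow, mul_one, mul_one, Real.Gamma_nat_eq_factorial,
      show α * ((n : ℝ) + 1) + (1 - α) = n * α + 1 by ring] at h1
    have h2 : (0:ℝ) < n.factorial := by positivity
    rw [Real.rpow_sub h2, Real.rpow_one]
    calc _ ≤ (n.factorial : ℝ) ^ α / n.factorial * K ^ n := by gcongr
      _ = _ := by field_simp

theorem aux_zeta_eq (α θ : ℝ) (hα0 : 0 < α) (hθ : 0 < θ) :
    zetaFn α θ = 1 / (α * Real.pi) * ∑' n : ℕ, (-1 : ℝ) ^ n * θ ^ n *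
      (Real.Gamma (((n : ℝ) + 1) * α + 1) / (Nat.factorial (n + 1) : ℝ)) *
      Real.sin (((n : ℝ) + 1) * Real.pi * α) := by
  unfold zetaFn wrightFn
  have h : ∀ n : ℕ, θ ^ (-1 - 1 / α) * (θ ^ (-(1 / α))) ^ (-(α * ((n : ℝ) + 1)) - 1) = θ ^ n := by
    intro n
    rw [← Real.rpow_mul hθ.le, ← Real.rpow_add hθ, ← Real.rpow_natCast]
    congr 1
    field_simp
    ring
  rw [mul_assoc, mul_left_comm (θ ^ (-1 - 1 / α)), ← tsum_mul_left, ← mul_assoc]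
  congr 1
  · field_simp
  · refine tsum_congr fun n => ?_
    rw [← h n]
    ring

theorem aux_bound (α θ : ℝ) (hα0 : 0 < α) (hα1 : α < 1) (hθ : 0 < θ) :
    |zetaFn α θ| ≤ 1 / (α * Real.pi) * θ⁻¹ *
      ((θ * Real.cos (Real.pi * α / (1 + α))) ^ (-1 / α) * Real.Gamma (1 / α + 1)) := by
  set φ : ℝ := Real.pi * α / (1 + α) with hφ
  have hφ0 : 0 < φ := by positivity
  have hφ2 : φ < Real.pi / 2 := by
    rw [hφ, div_lt_div_iff₀ (by positivity) (by positivity)]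
    nlinarith [Real.pi_pos]
  have hφe : α * (Real.pi - φ) = φ := by
    rw [hφ]; field_simp; ring
  have hc : 0 < Real.cos φ := Real.cos_pos_of_mem_Ioo ⟨by linarith, hφ2⟩
  set w : ℂ := Complex.exp ((-φ : ℝ) * Complex.I) with hw
  set β : ℂ := Complex.exp ((φ : ℝ) * Complex.I) with hβ
  have hwre : w.re = Real.cos φ := by rw [hw, Complex.exp_ofReal_mul_I_re, Real.cos_neg]
  have hβre : β.re = Real.cos φ := by rw [hβ, Complex.exp_ofReal_mul_I_re]
  have hwn : ‖w‖ = 1 := Complex.norm_exp_ofReal_mul_I _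
  have hβn : ‖β‖ = 1 := Complex.norm_exp_ofReal_mul_I _
  have hlog : Complex.log w = (-φ : ℝ) * Complex.I := by
    rw [hw, Complex.log_exp]
    · simp; linarith [Real.pi_pos]
    · simp; linarith [Real.pi_pos]
  have hw0 : 0 < w.re := hwre ▸ hc
  let F : ℕ → ℝ → ℂ := fun n r =>
    (w * ((-θ : ℝ) * β) ^ n / (n.factorial : ℂ)) * (((r ^ (n * α) : ℝ) : ℂ) * Complex.exp (-(w * r)))
  have hFint : ∀ n, Integrable (F n) (volume.restrict (Set.Ioi 0)) := fun n =>
    (aux_intC (n * α) w (by positivity) hw0).const_mul _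
  have hFn : ∀ n, ∀ r ∈ Set.Ioi (0:ℝ), ‖F n r‖ =
      (θ ^ n / n.factorial) * (r ^ (n * α) * Real.exp (-(w.re * r))) := by
    intro n r hr
    simp only [F]
    rw [norm_mul, aux_norm _ _ _ hr, norm_div, norm_mul, norm_pow, norm_mul, hwn, hβn,
      Complex.norm_real, Complex.norm_natCast, norm_neg, Real.norm_of_nonneg hθ.le]
    simp
  have hsum : Summable (fun n => ∫ r in Set.Ioi (0:ℝ), ‖F n r‖) := by
    have := (aux_summable α hα0 hα1 (θ * (1 / w.re) ^ α) (by positivity)).mul_left (1 / w.re)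
    refine this.congr fun n => ?_
    rw [setIntegral_congr_fun measurableSet_Ioi (hFn n), integral_const_mul]
    have h := Real.integral_rpow_mul_exp_neg_mul_Ioi (a := n * α + 1) (r := w.re) (by positivity) hw0
    rw [add_sub_cancel_right] at h
    rw [h, Real.rpow_add_one (by positivity), mul_comm (n : ℝ) α, Real.rpow_mul (by positivity),
      Real.rpow_natCast]
    ring
  have hmain := hasSum_integral_of_summable_integral_norm hFint hsum
  have hexp : ∀ r ∈ Set.Ioi (0:ℝ), ∑' n, F n r =
      w * Complex.exp (-θ * β * (r ^ α : ℝ)) * Complex.exp (-(w * r)) := by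
    intro r hr
    have hr : 0 < r := hr
    have h := (NormedSpace.expSeries_div_hasSum_exp (-θ * β * (r ^ α : ℝ) : ℂ))
    rw [← Complex.exp_eq_exp_ℂ] at h
    rw [← ((h.mul_left w).mul_right (Complex.exp (-(w * r)))).tsum_eq]
    refine tsum_congr fun n => ?_
    simp only [F]
    rw [mul_comm (n : ℝ) α, Real.rpow_mul hr.le, Real.rpow_natCast]
    push_cast
    rw [mul_pow _ ((r ^ α : ℝ) : ℂ)]
    ring
  rw [setIntegral_congr_fun measurableSet_Ioi hexp] at hmain
  set G : ℂ := ∫ r in Set.Ioi (0:ℝ),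
    w * Complex.exp (-θ * β * (r ^ α : ℝ)) * Complex.exp (-(w * r)) with hG
  have hGn : ‖G‖ ≤ (θ * Real.cos φ) ^ (-1 / α) * Real.Gamma (1 / α + 1) := by
    rw [← integral_exp_neg_mul_rpow hα0 (mul_pos hθ hc)]
    refine norm_integral_le_of_norm_le ?_ ?_
    · have := integrableOn_rpow_mul_exp_neg_mul_rpow (p := α) (s := 0) (b := θ * Real.cos φ)
        (by linarith) hα0 (mul_pos hθ hc)
      simpa [IntegrableOn] using this
    · filter_upwards [ae_restrict_mem measurableSet_Ioi] with r hr
      have hr : 0 < r := hr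
      rw [norm_mul, norm_mul, hwn, Complex.norm_exp, Complex.norm_exp, one_mul]
      have h1 : (-θ * β * (r ^ α : ℝ) : ℂ).re = -(θ * Real.cos φ) * r ^ α := by
        rw [Complex.re_mul_ofReal, ← Complex.ofReal_neg, Complex.re_ofReal_mul, hβre]; ring
      have h2 : (-(w * r) : ℂ).re = - (Real.cos φ * r) := by
        rw [Complex.neg_re, Complex.re_mul_ofReal, hwre]
      rw [h1, h2]
      have h3 : Real.exp (-(Real.cos φ * r)) ≤ 1 := Real.exp_le_one_iff.2 (by
        have := mul_pos hc hr
        linarith)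
      exact mul_le_of_le_one_right (Real.exp_pos _).le h3
  have hFI : ∀ n, (∫ r in Set.Ioi (0:ℝ), F n r) =
      (((-θ) ^ n / n.factorial * Real.Gamma (n * α + 1) : ℝ) : ℂ) *
        Complex.exp ((n * Real.pi * α : ℝ) * Complex.I) := by
    intro n
    simp only [F]
    rw [integral_const_mul, aux_gamma (n * α) (by positivity) w hw0, hlog]
    have : Complex.exp ((n * Real.pi * α : ℝ) * Complex.I) =
        w * β ^ n * Complex.exp (-((n * α + 1 : ℝ) * ((-φ : ℝ) * Complex.I))) := by
      rw [hw, hβ, ← Complex.exp_nat_mul, ← Complex.exp_add, ← Complex.exp_add]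
      congr 1
      have h5 : (n * Real.pi * α : ℝ) = -φ + n * φ + (n * α + 1) * φ := by
        linear_combination (n : ℝ) * hφe
      rw [h5]
      push_cast
      ring
    rw [this]
    push_cast
    ring
  have him := Complex.hasSum_im hmain
  have him2 : HasSum (fun n : ℕ => (-θ) ^ n / n.factorial * Real.Gamma (n * α + 1) *
      Real.sin (n * Real.pi * α)) G.im := by
    refine him.congr_fun fun n => ?_
    rw [hFI n, Complex.im_ofReal_mul, Complex.exp_ofReal_mul_I_im]
  have him3 := (hasSum_nat_add_iff' 1).2 him2
  simp only [Finset.sum_range_one, Nat.cast_zero, zero_mul, Real.sin_zero, mul_zero, sub_zero]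
    at him3
  have hz : zetaFn α θ = 1 / (α * Real.pi) * θ⁻¹ * (-G.im) := by
    rw [aux_zeta_eq α θ hα0 hθ, mul_assoc]
    congr 1
    rw [← him3.tsum_eq, ← tsum_neg, ← tsum_mul_left]
    refine tsum_congr fun n => ?_
    push_cast
    rw [neg_pow θ (n + 1), pow_succ, pow_succ]
    field_simp
  rw [hz, abs_mul, abs_of_pos (by positivity), abs_neg]
  gcongr
  exact (Complex.abs_im_le_norm G).trans hGn

theorem aux_integrable (α : ℝ) (hα0 : 0 < α) (hα1 : α < 1) (k : ℕ) (hk : k ≤ 1) :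
    IntegrableOn (fun θ => θ ^ k * zetaFn α θ) (Set.Ioi 0) := by
  let f : ℝ → ℝ := fun θ => θ ^ k * (1 / (α * Real.pi) * ∑' n : ℕ, (-1 : ℝ) ^ n * θ ^ n *
      (Real.Gamma (((n : ℝ) + 1) * α + 1) / (Nat.factorial (n + 1) : ℝ)) *
      Real.sin (((n : ℝ) + 1) * Real.pi * α))
  have hfe : ∀ θ ∈ Set.Ioi (0:ℝ), f θ = θ ^ k * zetaFn α θ := fun θ hθ => by
    rw [aux_zeta_eq α θ hα0 hθ]
  have hcont : ∀ R : ℝ, 0 < R → ContinuousOn f (Set.Icc 0 R) := by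
    intro R hR
    refine ContinuousOn.mul (by fun_prop) (ContinuousOn.mul continuousOn_const ?_)
    have hs := ((summable_nat_add_iff 1).2 (aux_summable α hα0 hα1 R hR)).mul_right R⁻¹
    refine continuousOn_tsum (fun n => by fun_prop) hs ?_
    intro n x hx
    have hG : 0 < Real.Gamma (((n : ℝ) + 1) * α + 1) := Real.Gamma_pos_of_pos (by positivity)
    rw [norm_mul, norm_mul, norm_mul, norm_pow, norm_neg, norm_one, one_pow, one_mul, norm_pow,
      Real.norm_of_nonneg hx.1, Real.norm_of_nonneg (by positivity : (0:ℝ) ≤ Real.Gamma (((n : ℝ) + 1) * α + 1) / (Nat.factorial (n + 1) : ℝ))]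
    have h1 : ‖Real.sin (((n : ℝ) + 1) * Real.pi * α)‖ ≤ 1 := Real.abs_sin_le_one _
    have h2 : x ^ n ≤ R ^ n := pow_le_pow_left₀ hx.1 hx.2 n
    calc _ ≤ R ^ n * (Real.Gamma (((n : ℝ) + 1) * α + 1) / (Nat.factorial (n + 1) : ℝ)) * 1 := by
          gcongr
      _ = _ := by
          push_cast
          rw [pow_succ]
          field_simp
  rw [integrableOn_congr_fun (fun θ hθ => (hfe θ hθ).symm) measurableSet_Ioi,
    ← Set.Ioc_union_Ioi_eq_Ioi (zero_le_one' ℝ)]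
  refine IntegrableOn.union ?_ ?_
  · exact ((hcont 1 one_pos).integrableOn_compact isCompact_Icc).mono_set Set.Ioc_subset_Icc_self
  · have hc1 : ContinuousOn f (Set.Ioi 1) := by
      intro x hx
      have hx : 1 < x := hx
      exact ((hcont (x + 1) (by linarith)).continuousAt
        (Icc_mem_nhds (by linarith) (by linarith))).continuousWithinAt
    have hdom := (integrableOn_Ioi_rpow_of_lt (a := -1 / α) (c := 1)
      (by rw [div_lt_iff₀ hα0]; linarith) one_pos).const_mul (1 / (α * Real.pi) *
        (Real.cos (Real.pi * α / (1 + α)) ^ (-1 / α) * Real.Gamma (1 / α + 1)))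
    refine hdom.mono' (hc1.aestronglyMeasurable measurableSet_Ioi) ?_
    filter_upwards [ae_restrict_mem measurableSet_Ioi] with θ hθ
    have hθ1 : 1 < θ := hθ
    have hθ0 : 0 < θ := by linarith
    have hb := aux_bound α θ hα0 hα1 hθ0
    have hc : 0 ≤ Real.cos (Real.pi * α / (1 + α)) := by
      have : Real.pi * α / (1 + α) ≤ Real.pi / 2 := by
        rw [div_le_div_iff₀ (by positivity) (by positivity)]
        nlinarith [Real.pi_pos]
      exact Real.cos_nonneg_of_mem_Icc ⟨by
        have : 0 ≤ Real.pi * α / (1 + α) := by positivity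
        linarith [Real.pi_pos], this⟩
    rw [hfe θ hθ0, norm_mul, norm_pow, Real.norm_of_nonneg hθ0.le]
    have hk1 : θ ^ k ≤ θ ^ 1 := pow_le_pow_right₀ hθ1.le hk
    calc θ ^ k * ‖zetaFn α θ‖ ≤ θ ^ 1 * (1 / (α * Real.pi) * θ⁻¹ *
      ((θ * Real.cos (Real.pi * α / (1 + α))) ^ (-1 / α) * Real.Gamma (1 / α + 1))) :=
          mul_le_mul hk1 hb (norm_nonneg _) (by positivity)
      _ = _ := by
          rw [Real.mul_rpow hθ0.le hc]
          field_simp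

theorem uniform_operator_norm_continuity_of_S_and_T
    {X Y : Type*} [NormedAddCommGroup X] [NormedSpace ℝ X] [CompleteSpace X]
    [NormedAddCommGroup Y] [NormedSpace ℝ Y] [CompleteSpace Y]
    (Linv : Y →L[ℝ] X)
    (Q : ℝ → Y →L[ℝ] Y) (M₀ : ℝ) (hQ : ∀ t, 0 ≤ t → ‖Q t‖ ≤ M₀)
    (hQnormcont : ContinuousOn Q (Set.Ioi 0))
    (α : ℝ) (hα0 : 0 < α) (hα1 : α < 1)
    (S T : ℝ → Y →L[ℝ] X)
    (hS : ∀ t, 0 ≤ t → ∀ u : Y,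
      S t u = ∫ θ in Set.Ioi (0 : ℝ), zetaFn α θ • Linv (Q (t ^ α * θ) u))
    (hT : ∀ t, 0 ≤ t → ∀ u : Y,
      T t u = α • ∫ θ in Set.Ioi (0 : ℝ), (θ * zetaFn α θ) • Linv (Q (t ^ α * θ) u)) :
    ∀ t : ℝ, 0 < t → ∀ ε : ℝ, 0 < ε → ∃ g : ℝ, 0 < g ∧
      ∀ ε' : ℝ, 0 < t + ε' → |ε'| < g →
        ‖S (t + ε') - S t‖ < ε ∧ ‖T (t + ε') - T t‖ < ε := by
  have hi0 := aux_integrable α hα0 hα1 0 (by norm_num)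
  have hi1 := aux_integrable α hα0 hα1 1 le_rfl
  simp only [pow_zero, one_mul, pow_one] at hi0 hi1
  intro t ht ε hε
  have hSc := aux_cont Linv Q M₀ hQ hQnormcont α _ hi0 S hS t ht
  have hTc := aux_cont Linv Q M₀ hQ hQnormcont α _ (hi1.const_mul α) T (fun s hs u => by
    rw [hT s hs u, ← integral_smul]
    simp only [smul_smul]) t ht
  obtain ⟨g₁, hg₁, h₁⟩ := Metric.continuousAt_iff.1 hSc ε hε
  obtain ⟨g₂, hg₂, h₂⟩ := Metric.continuousAt_iff.1 hTc ε hε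
  refine ⟨min g₁ g₂, lt_min hg₁ hg₂, fun e _ he => ?_⟩
  have hd : dist (t + e) t = |e| := by rw [Real.dist_eq, add_sub_cancel_left]
  rw [← dist_eq_norm, ← dist_eq_norm]
  exact ⟨h₁ (hd ▸ he.trans_le (min_le_left _ _)), h₂ (hd ▸ he.trans_le (min_le_right _ _))⟩
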